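/- For every polymatroid h on 2^[n] there exists a normal polymatroid h' (a non-negative linear combination of step functions) such that: (1) h'(X) ≤ h(X) for all X ⊆ [n]; (2) h'([n]) = h([n]); and (3) h'({i}) = h({i}) for every i ∈ [n]. -/

import Mathlib

/-- The step function at `W`: `0` on subsets of `W`, `1` otherwise. -/
def stepFn {n : ℕ} (W X : Finset (Fin n)) : ℝ := if X ⊆ W then 0 else 1

/-- A normal polymatroid: a non-negative linear combination of step functions `h_W`, `W ⊊ [n]`. -/
def IsNormal {n : ℕ} (h : Finset (Fin n) → ℝ) : Prop :=
  ∃ c : Finset (Fin n) → ℝ, (∀ W, 0 ≤ c W) ∧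
    ∀ X, h X = ∑ W ∈ Finset.univ.filter (fun W => W ≠ Finset.univ), c W * stepFn W X

/-- A polymatroid on `[n]`: non-negative, zero on `∅`, monotone and submodular. -/
def IsPolymatroid {n : ℕ} (h : Finset (Fin n) → ℝ) : Prop :=
  h ∅ = 0 ∧ (∀ X, 0 ≤ h X) ∧
    (∀ X Y : Finset (Fin n), h X ≤ h (X ∪ Y)) ∧
    (∀ X Y : Finset (Fin n), h (X ∪ Y) + h (X ∩ Y) ≤ h X + h Y)

open scoped NNReal

theorem IsNormal.add {n : ℕ} {f g : Finset (Fin n) → ℝ} (hf : IsNormal f) (hg : IsNormal g) :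
    IsNormal (fun X => f X + g X) := by
  obtain ⟨c, hc, hfc⟩ := hf
  obtain ⟨d, hd, hgd⟩ := hg
  refine ⟨fun W => c W + d W, fun W => add_nonneg (hc W) (hd W), fun X => ?_⟩
  simp only [hfc, hgd, add_mul, Finset.sum_add_distrib]

theorem isNormal_zero {n : ℕ} : IsNormal (fun _ : Finset (Fin n) => (0 : ℝ)) :=
  ⟨0, fun _ => le_rfl, fun _ => by simp⟩

theorem isNormal_const_mul_stepFn {n : ℕ} {r : ℝ} (hr : 0 ≤ r) {W : Finset (Fin n)}
    (hW : W ≠ Finset.univ) : IsNormal (fun X => r * stepFn W X) := by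
  refine ⟨Pi.single W r, fun V => ?_, fun X => ?_⟩
  · by_cases hV : V = W
    · subst hV; simpa using hr
    · simp [hV]
  · rw [Finset.sum_eq_single W]
    · simp
    · intro V _ hV
      simp [hV]
    · simp [hW]

/-- The supremum of non-negative weights is normal: peel off the least positive weight. -/
theorem isNormal_sup {n : ℕ} (a : Fin n → ℝ≥0) : IsNormal (fun X => ((X.sup a : ℝ≥0) : ℝ)) := by
  induction hk : (Finset.univ.filter (fun i => a i ≠ 0)).card using Nat.strong_induction_on
    generalizing a with
  | _ k ih =>
  set S := Finset.univ.filter (fun i => a i ≠ 0) with hS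
  rcases S.eq_empty_or_nonempty with h0 | hne
  · have ha : ∀ i, a i = 0 := fun i => by
      by_contra hi
      have : i ∈ S := by simp [hS, hi]
      simp [h0] at this
    have hz : ∀ X : Finset (Fin n), X.sup a = 0 := fun X => by
      rw [← bot_eq_zero, Finset.sup_eq_bot_iff]
      exact fun i _ => ha i
    simpa only [hz, NNReal.coe_zero] using isNormal_zero
  obtain ⟨j, hjS, hj⟩ := S.exists_min_image a hne
  have hpos : a j ≠ 0 := by simpa [hS] using hjS
  have hlt : (Finset.univ.filter (fun i => a i - a j ≠ 0)).card < k := by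
    rw [← hk]
    refine Finset.card_lt_card (Finset.ssubset_iff_of_subset ?_ |>.2 ⟨j, hjS, by simp⟩)
    intro i hi
    simp only [Finset.mem_filter, Finset.mem_univ, true_and, hS] at hi ⊢
    rintro h
    simp [h] at hi
  have hW : Sᶜ ≠ Finset.univ := fun h => by
    have : j ∈ Sᶜ := h ▸ Finset.mem_univ j
    simp [hjS] at this
  have hsum := (isNormal_const_mul_stepFn (a j).coe_nonneg hW).add (ih _ hlt _ rfl)
  convert hsum using 2 with X
  have hsub : X.sup (fun i => a i - a j) = X.sup a - a j :=
    (Finset.apply_sup_eq_sup_comp (fun x => x - a j)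
      (fun x y => Monotone.map_sup (fun _ _ hxy => tsub_le_tsub_right hxy (a j)) x y) (by simp)).symm
  rw [hsub]
  unfold stepFn
  split_ifs with hX
  · have hz : X.sup a = 0 := by
      rw [← bot_eq_zero, Finset.sup_eq_bot_iff]
      intro i hi
      simpa [hS] using hX hi
    simp [hz]
  · obtain ⟨i, hiX, hi⟩ := Finset.not_subset.1 hX
    have hle : a j ≤ X.sup a := (hj i (by simpa using hi)).trans (Finset.le_sup hiX)
    rw [NNReal.coe_sub hle]
    ring

theorem IsPolymatroid.mono {n : ℕ} {h : Finset (Fin n) → ℝ} (hp : IsPolymatroid h)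
    {X Y : Finset (Fin n)} (hXY : X ⊆ Y) : h X ≤ h Y := by
  simpa [Finset.union_eq_right.2 hXY] using hp.2.2.1 X Y

/-- Conditioning a polymatroid on an element. -/
theorem IsPolymatroid.contract {n : ℕ} {h : Finset (Fin n) → ℝ} (hp : IsPolymatroid h)
    (j : Fin n) : IsPolymatroid (fun X => h (insert j X) - h {j}) := by
  refine ⟨by simp, fun X => sub_nonneg.2 (hp.mono (by simp)), fun X Y => ?_, fun X Y => ?_⟩
  · exact sub_le_sub_right (hp.mono (Finset.insert_subset_insert _ Finset.subset_union_left)) _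
  · have := hp.2.2.2 (insert j X) (insert j Y)
    rw [← Finset.insert_union_distrib, ← Finset.insert_inter_distrib] at this
    linarith

theorem IsPolymatroid.apply_le_sum {n : ℕ} {h : Finset (Fin n) → ℝ} (hp : IsPolymatroid h)
    (X : Finset (Fin n)) : h X ≤ ∑ i ∈ X, h {i} := by
  induction X using Finset.induction_on with
  | empty => simp [hp.1]
  | insert i X hi ih =>
    have h1 := hp.2.2.2 {i} X
    have h2 := hp.2.1 ({i} ∩ X)
    rw [Finset.sum_insert hi, Finset.insert_eq]
    linarith

/-- The mutual information of `j` with a member of `X` is at most that of `j` with `X`. -/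
theorem IsPolymatroid.mutual_le {n : ℕ} {h : Finset (Fin n) → ℝ} (hp : IsPolymatroid h)
    {i j : Fin n} {X : Finset (Fin n)} (hi : i ∈ X) :
    h {i} + h {j} - h (insert j {i}) ≤ h X + h {j} - h (insert j X) := by
  have h1 := hp.2.2.2 X (insert j {i})
  have h2 : h {i} ≤ h (X ∩ insert j {i}) := hp.mono (by simp [hi])
  have h3 : h (insert j X) ≤ h (X ∪ insert j {i}) := hp.mono (by
    intro k
    simp only [Finset.mem_insert, Finset.mem_union]
    tauto)
  linarith

theorem IsPolymatroid.exists_isNormal_le {n : ℕ} (S : Finset (Fin n)) {h : Finset (Fin n) → ℝ}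
    (hp : IsPolymatroid h) (hS : ∀ i ∉ S, h {i} = 0) :
    ∃ h' : Finset (Fin n) → ℝ, IsNormal h' ∧ (∀ X, h' X ≤ h X) ∧
      h' Finset.univ = h Finset.univ ∧ ∀ i, h' {i} = h {i} := by
  induction S using Finset.induction_on generalizing h with
  | empty =>
    refine ⟨_, isNormal_zero, hp.2.1, le_antisymm (hp.2.1 _) ?_, fun i => (hS i (by simp)).symm⟩
    exact (hp.apply_le_sum _).trans_eq (Finset.sum_eq_zero fun i _ => hS i (by simp))
  | insert j S _ ih =>
    have hmut : ∀ i, 0 ≤ h {i} + h {j} - h (insert j {i}) := fun i => by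
      have h1 := hp.2.2.2 {j} {i}
      have h2 := hp.2.1 ({j} ∩ {i})
      rw [← Finset.insert_eq] at h1
      linarith
    obtain ⟨g, hgN, hgle, hgu, hgs⟩ := ih (hp.contract j) fun i hi => by
      by_cases hij : i = j
      · simp [hij]
      · have h1 := hS i (by simp [hij, hi])
        have h2 := hmut i
        have h3 : h {j} ≤ h (insert j {i}) := hp.mono (by simp)
        linarith
    let a : Fin n → ℝ≥0 := fun i => ⟨h {i} + h {j} - h (insert j {i}), hmut i⟩
    have hsup : ∀ X : Finset (Fin n), ((X.sup a : ℝ≥0) : ℝ) ≤ h X + h {j} - h (insert j X) := by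
      intro X
      have h0 : 0 ≤ h X + h {j} - h (insert j X) := by
        have h1 := hp.2.2.2 {j} X
        have h2 := hp.2.1 ({j} ∩ X)
        rw [← Finset.insert_eq] at h1
        linarith
      have : X.sup a ≤ ⟨_, h0⟩ := Finset.sup_le fun i hi => hp.mutual_le hi
      exact this
    refine ⟨_, hgN.add (isNormal_sup a), fun X => ?_, ?_, fun i => ?_⟩
    · have h1 := hgle X
      have h2 := hsup X
      linarith
    · have h1 := hsup Finset.univ
      have h2 : ((a j : ℝ≥0) : ℝ) ≤ (Finset.univ.sup a : ℝ≥0) :=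
        NNReal.coe_le_coe.2 (Finset.le_sup (Finset.mem_univ j))
      have h3 : ((a j : ℝ≥0) : ℝ) = h {j} + h {j} - h (insert j {j}) := rfl
      simp only [Finset.insert_eq_of_mem (Finset.mem_univ j), Finset.insert_eq_of_mem
        (Finset.mem_singleton_self j)] at h1 h3 hgu
      linarith
    · have h1 : ((a i : ℝ≥0) : ℝ) = h {i} + h {j} - h (insert j {i}) := rfl
      rw [Finset.sup_singleton, h1, hgs]
      ring

theorem normal_domination {n : ℕ} (h : Finset (Fin n) → ℝ) (hp : IsPolymatroid h) :
    ∃ h' : Finset (Fin n) → ℝ, IsNormal h' ∧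
      (∀ X : Finset (Fin n), h' X ≤ h X) ∧
      h' Finset.univ = h Finset.univ ∧
      (∀ i : Fin n, h' {i} = h {i}) := by
  exact hp.exists_isNormal_le Finset.univ (by simp)
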